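/- arXiv:1903.10977 — 4 statements merged into one kernel-verified Lean document; each statement's English description precedes it below -/
import Mathlib

section
/- Let A be a real n×n symmetric positive definite matrix, and suppose A = Σ_{i=1}^{E} B_i where each B_i is a real symmetric positive semidefinite matrix (the element matrices A^{K_i}). Let P_1, …, P_N be the prolongation matrices of an additive Schwarz setup for A, with block matrices A_j = P_jᵀ A P_j and preconditioner M⁻¹ = Σ_{j=1}^{N} P_j A_j⁻¹ P_jᵀ. For each i ∈ {1,…,E} let N_i denote the number of indices j ∈ {1,…,N} with B_i P_j ≠ 0 (the number of blocks containing basis functions supported on element K_i). Then every eigenvalue of M⁻¹ A is at most max_{1 ≤ i ≤ E} N_i; in particular λ_max(M⁻¹A) ≤ max_i N_i. -/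
open Matrix BigOperators

lemma Matrix.IsSymm.dotProduct_mulVec_comm {ι : Type*} [Fintype ι] {S : Matrix ι ι ℝ}
    (hS : S.IsSymm) (x y : ι → ℝ) : x ⬝ᵥ S *ᵥ y = y ⬝ᵥ S *ᵥ x := by
  rw [dotProduct_mulVec, ← mulVec_transpose, hS, dotProduct_comm]

lemma Matrix.PosSemidef.dotProduct_mulVec_sum_le {ι κ : Type*} [Fintype ι]
    {B : Matrix ι ι ℝ} (hB : B.PosSemidef) (s : Finset κ) (w : κ → ι → ℝ) :
    (∑ j ∈ s, w j) ⬝ᵥ B *ᵥ (∑ j ∈ s, w j) ≤ s.card * ∑ j ∈ s, w j ⬝ᵥ B *ᵥ w j := by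
  have hsymm : Bᵀ = B := by simpa using hB.isHermitian.eq
  have hpair (j k : κ) :
      w j ⬝ᵥ B *ᵥ w k ≤ (w j ⬝ᵥ B *ᵥ w j + w k ⬝ᵥ B *ᵥ w k) / 2 := by
    have h : 0 ≤ (w j - w k) ⬝ᵥ B *ᵥ (w j - w k) := by
      simpa using hB.dotProduct_mulVec_nonneg (w j - w k)
    rw [mulVec_sub, dotProduct_sub, sub_dotProduct, sub_dotProduct,
      IsSymm.dotProduct_mulVec_comm hsymm (w k) (w j)] at h
    linarith
  calc (∑ j ∈ s, w j) ⬝ᵥ B *ᵥ (∑ j ∈ s, w j)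
      = ∑ j ∈ s, ∑ k ∈ s, w j ⬝ᵥ B *ᵥ w k := by
        simp only [mulVec_sum, sum_dotProduct, dotProduct_sum]
        exact Finset.sum_comm
    _ ≤ ∑ j ∈ s, ∑ k ∈ s, (w j ⬝ᵥ B *ᵥ w j + w k ⬝ᵥ B *ᵥ w k) / 2 :=
        Finset.sum_le_sum fun j _ => Finset.sum_le_sum fun k _ => hpair j k
    _ = s.card * ∑ j ∈ s, w j ⬝ᵥ B *ᵥ w j := by
        simp only [← Finset.sum_div, Finset.sum_add_distrib, Finset.sum_const, nsmul_eq_mul,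
          ← Finset.mul_sum]
        ring

/-- If `A` is positive definite and `A * C` is symmetric, then every complex eigenvalue of `C` is
real and has a real eigenvector. -/
lemma Matrix.PosDef.im_eq_zero_and_exists_mulVec_eq_smul {ι : Type*} [Fintype ι] [DecidableEq ι]
    {A C : Matrix ι ι ℝ} (hA : A.PosDef) (hAC : (A * C)ᵀ = A * C) {μ : ℂ}
    (hμ : μ ∈ spectrum ℂ (C.map Complex.ofReal)) :
    μ.im = 0 ∧ ∃ w : ι → ℝ, w ≠ 0 ∧ C *ᵥ w = μ.re • w := by
  rw [← spectrum_toLin', ← Module.End.hasEigenvalue_iff_mem_spectrum] at hμ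
  obtain ⟨v, hv⟩ := hμ.exists_hasEigenvector
  have hCv : C.map Complex.ofReal *ᵥ v = μ • v := by simpa using hv.apply_eq_smul
  set x : ι → ℝ := fun i => (v i).re with hx
  set y : ι → ℝ := fun i => (v i).im with hy
  have hCx : C *ᵥ x = μ.re • x - μ.im • y := by
    ext i
    simpa [mulVec, dotProduct, hx, hy] using congrArg Complex.re (congrFun hCv i)
  have hCy : C *ᵥ y = μ.re • y + μ.im • x := by
    ext i
    simpa [mulVec, dotProduct, hx, hy] using congrArg Complex.im (congrFun hCv i)
  have hxy : x ≠ 0 ∨ y ≠ 0 := by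
    by_contra! h
    refine hv.2 (funext fun i => Complex.ext ?_ ?_)
    · exact congrFun h.1 i
    · exact congrFun h.2 i
  have hA0 : Aᵀ = A := by simpa using hA.isHermitian.eq
  have hnn (z : ι → ℝ) : 0 ≤ z ⬝ᵥ A *ᵥ z := by
    simpa using hA.posSemidef.dotProduct_mulVec_nonneg z
  have hpos (z : ι → ℝ) (hz : z ≠ 0) : 0 < z ⬝ᵥ A *ᵥ z := by
    simpa using hA.dotProduct_mulVec_pos hz
  have hsum : 0 < x ⬝ᵥ A *ᵥ x + y ⬝ᵥ A *ᵥ y := by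
    rcases hxy with h | h
    · linarith [hpos x h, hnn y]
    · linarith [hpos y h, hnn x]
  have him : μ.im = 0 := by
    have h := IsSymm.dotProduct_mulVec_comm hAC x y
    simp only [← mulVec_mulVec, hCx, hCy, mulVec_add, mulVec_sub, mulVec_smul, dotProduct_add,
      dotProduct_sub, dotProduct_smul, smul_eq_mul, IsSymm.dotProduct_mulVec_comm hA0 y x] at h
    have h0 : μ.im * (x ⬝ᵥ A *ᵥ x + y ⬝ᵥ A *ᵥ y) = 0 := by linarith
    exact (mul_eq_zero.mp h0).resolve_right hsum.ne'
  refine ⟨him, ?_⟩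
  rcases hxy with h | h
  · exact ⟨x, h, by simpa [him] using hCx⟩
  · exact ⟨y, h, by simpa [him] using hCy⟩

/-- The Galerkin correction `w = P (Pᵀ A P)⁻¹ Pᵀ A z` is an `A`-orthogonal projection of `z`. -/
lemma Matrix.PosDef.dotProduct_mulVec_galerkin {ι κ : Type*} [Fintype ι] [Fintype κ]
    [DecidableEq κ] {A : Matrix ι ι ℝ} (hA : A.PosDef) {P : Matrix ι κ ℝ}
    (hP : Function.Injective P.mulVec) {z w : ι → ℝ}
    (hw : w = (P * (Pᵀ * A * P)⁻¹ * Pᵀ) *ᵥ A *ᵥ z) :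
    w ⬝ᵥ A *ᵥ w = w ⬝ᵥ A *ᵥ z := by
  have hpd : (Pᵀ * A * P).PosDef := by
    simpa using hA.conjTranspose_mul_mul_same hP
  have hdet : IsUnit (Pᵀ * A * P).det := hpd.det_pos.ne'.isUnit
  set y := (Pᵀ * A * P)⁻¹ *ᵥ Pᵀ *ᵥ A *ᵥ z with hy
  have hwy : w = P *ᵥ y := by
    rw [hw, hy]; simp only [mulVec_mulVec, Matrix.mul_assoc]
  have hres : Pᵀ *ᵥ A *ᵥ w = Pᵀ *ᵥ A *ᵥ z := by
    have h : Pᵀ *ᵥ A *ᵥ w = (Pᵀ * A * P) *ᵥ y := by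
      rw [hwy]; simp only [mulVec_mulVec, Matrix.mul_assoc]
    rw [h, hy, mulVec_mulVec, mul_nonsing_inv _ hdet, one_mulVec]
  have hadj (u : ι → ℝ) : w ⬝ᵥ u = y ⬝ᵥ Pᵀ *ᵥ u := by
    rw [hwy, mulVec_transpose, dotProduct_comm, dotProduct_mulVec, dotProduct_comm]
  rw [hadj, hadj, hres]

/-- Bound on the largest eigenvalue of the additive-Schwarz-preconditioned system:
if the SPD matrix `A` is a sum of PSD element matrices `B i`, and `Ni i` counts the
Schwarz blocks `j` interacting with element `i` (i.e. `B i * P j ≠ 0`), then every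
eigenvalue of `M⁻¹ A` is real and at most `max_i Ni i`. -/
theorem stmt_0 (n N E : ℕ) (A : Matrix (Fin n) (Fin n) ℝ) (hA : A.PosDef)
    (B : Fin E → Matrix (Fin n) (Fin n) ℝ) (hB : ∀ i, (B i).PosSemidef)
    (hsum : A = ∑ i, B i)
    (nj : Fin N → ℕ) (P : (j : Fin N) → Matrix (Fin n) (Fin (nj j)) ℝ)
    (hrank : ∀ j, Function.Injective (P j).mulVec)
    (hspan : ∀ z : Fin n → ℝ, ∃ zs : (j : Fin N) → Fin (nj j) → ℝ,
      z = ∑ j, (P j).mulVec (zs j))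
    (Minv : Matrix (Fin n) (Fin n) ℝ)
    (hMinv : Minv = ∑ j, P j * ((P j)ᵀ * A * P j)⁻¹ * (P j)ᵀ)
    (Ni : Fin E → ℕ)
    (hNi : ∀ i, Ni i = Nat.card {j : Fin N // B i * P j ≠ 0}) :
    ∀ μ ∈ spectrum ℂ ((Minv * A).map Complex.ofReal),
      μ.im = 0 ∧ μ.re ≤ ((Finset.univ.sup Ni : ℕ) : ℝ) := by
  classical
  intro μ hμ
  have hAt : Aᵀ = A := by simpa using hA.isHermitian.eq
  have hMt : Minvᵀ = Minv := by
    simp [hMinv, transpose_sum, transpose_mul, transpose_nonsing_inv, hAt, Matrix.mul_assoc]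
  have hAC : (A * (Minv * A))ᵀ = A * (Minv * A) := by
    simp [transpose_mul, hAt, hMt, Matrix.mul_assoc]
  obtain ⟨him, z, hz, hCz⟩ := hA.im_eq_zero_and_exists_mulVec_eq_smul hAC hμ
  refine ⟨him, ?_⟩
  set K : ℝ := ((Finset.univ.sup Ni : ℕ) : ℝ) with hK
  have hK0 : 0 ≤ K := Nat.cast_nonneg _
  set w : Fin N → Fin n → ℝ :=
    fun j => (P j * ((P j)ᵀ * A * P j)⁻¹ * (P j)ᵀ) *ᵥ A *ᵥ z with hw
  have hwsum : ∑ j, w j = μ.re • z := by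
    rw [← hCz, ← mulVec_mulVec, hMinv, sum_mulVec]
  have hBw (i : Fin E) (j : Fin N) (h : B i * P j = 0) : B i *ᵥ w j = 0 := by
    simp only [hw, mulVec_mulVec, ← Matrix.mul_assoc, h, Matrix.zero_mul, zero_mulVec]
  have helem (i : Fin E) :
      (∑ j, w j) ⬝ᵥ B i *ᵥ (∑ j, w j) ≤ K * ∑ j, w j ⬝ᵥ B i *ᵥ w j := by
    have hBt : (B i)ᵀ = B i := by simpa using (hB i).isHermitian.eq
    set s : Finset (Fin N) := Finset.univ.filter fun j => B i * P j ≠ 0 with hs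
    have hzero (j : Fin N) (hj : j ∉ s) : B i *ᵥ w j = 0 := hBw i j (by simpa [hs] using hj)
    have hcard : (s.card : ℝ) ≤ K := by
      have h : s.card = Ni i := by
        rw [hNi, Nat.card_eq_fintype_card, Fintype.card_subtype]
      rw [h, hK]
      exact_mod_cast Finset.le_sup (Finset.mem_univ i)
    have hBsum : B i *ᵥ (∑ j, w j) = B i *ᵥ (∑ j ∈ s, w j) := by
      rw [mulVec_sum, mulVec_sum]
      exact (Finset.sum_subset s.subset_univ fun j _ hj => hzero j hj).symm
    have hdiag : ∑ j, w j ⬝ᵥ B i *ᵥ w j = ∑ j ∈ s, w j ⬝ᵥ B i *ᵥ w j :=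
      (Finset.sum_subset s.subset_univ fun j _ hj => by simp [hzero j hj]).symm
    rw [hBsum, IsSymm.dotProduct_mulVec_comm hBt, hBsum, hdiag]
    refine ((hB i).dotProduct_mulVec_sum_le s w).trans
      (mul_le_mul_of_nonneg_right hcard (Finset.sum_nonneg fun j _ => ?_))
    simpa using (hB i).dotProduct_mulVec_nonneg (w j)
  have hAB (x y : Fin n → ℝ) : x ⬝ᵥ A *ᵥ y = ∑ i, x ⬝ᵥ B i *ᵥ y := by
    rw [hsum, sum_mulVec, dotProduct_sum]
  have hbound : (∑ j, w j) ⬝ᵥ A *ᵥ (∑ j, w j) ≤ K * ((∑ j, w j) ⬝ᵥ A *ᵥ z) := by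
    calc (∑ j, w j) ⬝ᵥ A *ᵥ (∑ j, w j)
        ≤ ∑ i, K * ∑ j, w j ⬝ᵥ B i *ᵥ w j := by
          rw [hAB]; exact Finset.sum_le_sum fun i _ => helem i
      _ = K * ∑ j, w j ⬝ᵥ A *ᵥ w j := by
          rw [← Finset.mul_sum, Finset.sum_comm]; simp only [hAB]
      _ = K * ((∑ j, w j) ⬝ᵥ A *ᵥ z) := by
          rw [sum_dotProduct]
          exact congrArg _ (Finset.sum_congr rfl fun j _ =>
            hA.dotProduct_mulVec_galerkin (hrank j) rfl)
  have hpos : 0 < z ⬝ᵥ A *ᵥ z := by simpa using hA.dotProduct_mulVec_pos hz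
  simp only [hwsum, mulVec_smul, dotProduct_smul, smul_dotProduct, smul_eq_mul] at hbound
  by_contra! h
  have hμ0 : 0 < μ.re * (z ⬝ᵥ A *ᵥ z) := mul_pos (hK0.trans_lt h) hpos
  nlinarith [mul_lt_mul_of_pos_right h hμ0]
end

section
/- Let A ∈ ℝ^{n×n} be symmetric positive definite and let P_1,…,P_N with A_j = P_jᵀAP_j and M⁻¹ = Σ_{j=1}^N P_j A_j⁻¹ P_jᵀ be an additive Schwarz setup for A (additive Schwarz lemma). Then M⁻¹ is invertible, its inverse M is symmetric positive definite, and for every z ∈ ℝⁿ the quadratic form of M is characterized by zᵀ M z = min { Σ_{j=1}^N z_jᵀ A_j z_j : z_j ∈ ℝ^{n_j} for each j and Σ_{j=1}^N P_j z_j = z }, the minimum being taken over all decompositions of z and being attained. -/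
open Matrix BigOperators

namespace AdditiveSchwarz

variable {ι m : Type*} [Fintype ι] [Fintype m] {κ : ι → Type*}
  [∀ j, Fintype (κ j)] {P : ∀ j, Matrix m (κ j) ℝ}

theorem dotProduct_sum_mulVec (x : m → ℝ) (zs : ∀ j, κ j → ℝ) :
    x ⬝ᵥ ∑ j, P j *ᵥ zs j = ∑ j, zs j ⬝ᵥ ((P j)ᵀ *ᵥ x) := by
  simp only [dotProduct_sum, dotProduct_mulVec, mulVec_transpose]
  exact Finset.sum_congr rfl fun j _ => dotProduct_comm _ _

variable [∀ j, DecidableEq (κ j)]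

/-- The additive Schwarz operator with local matrices `B j` and prolongations `P j`. -/
noncomputable def operator (P : ∀ j, Matrix m (κ j) ℝ) (B : ∀ j, Matrix (κ j) (κ j) ℝ) :
    Matrix m m ℝ :=
  ∑ j, P j * (B j)⁻¹ * (P j)ᵀ

variable {B : ∀ j, Matrix (κ j) (κ j) ℝ}

theorem operator_mulVec (x : m → ℝ) :
    operator P B *ᵥ x = ∑ j, P j *ᵥ ((B j)⁻¹ *ᵥ ((P j)ᵀ *ᵥ x)) := by
  simp [operator, sum_mulVec, mulVec_mulVec, Matrix.mul_assoc]

theorem operator_posDef (hB : ∀ j, (B j).PosDef)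
    (hspan : ∀ z : m → ℝ, ∃ zs : ∀ j, κ j → ℝ, z = ∑ j, P j *ᵥ zs j) :
    (operator P B).PosDef := by
  have hpsd : (operator P B).PosSemidef := by
    refine posSemidef_sum _ fun j _ => ?_
    simpa using (hB j).inv.posSemidef.mul_mul_conjTranspose_same (P j)
  refine PosDef.of_dotProduct_mulVec_pos hpsd.isHermitian fun {x} hx => ?_
  rw [star_trivial, operator_mulVec, dotProduct_sum_mulVec]
  have hnonneg : ∀ j, 0 ≤ ((B j)⁻¹ *ᵥ ((P j)ᵀ *ᵥ x)) ⬝ᵥ ((P j)ᵀ *ᵥ x) := fun j => by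
    rw [dotProduct_comm]
    simpa using (hB j).inv.posSemidef.dotProduct_mulVec_nonneg ((P j)ᵀ *ᵥ x)
  obtain ⟨j, hj⟩ : ∃ j, (P j)ᵀ *ᵥ x ≠ 0 := by
    by_contra! h
    obtain ⟨zs, hzs⟩ := hspan x
    apply hx
    rw [← dotProduct_self_eq_zero]
    nth_rewrite 2 [hzs]
    simp [dotProduct_sum_mulVec, h]
  refine Finset.sum_pos' (fun j _ => hnonneg j) ⟨j, Finset.mem_univ j, ?_⟩
  rw [dotProduct_comm]
  simpa using (hB j).inv.dotProduct_mulVec_pos hj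

theorem two_mul_dotProduct_sub_le {k : Type*} [Fintype k] {C : Matrix k k ℝ}
    (hC : C.PosSemidef) (x y : k → ℝ) :
    2 * (x ⬝ᵥ (C *ᵥ y)) - y ⬝ᵥ (C *ᵥ y) ≤ x ⬝ᵥ (C *ᵥ x) := by
  have hsymm : y ⬝ᵥ (C *ᵥ x) = x ⬝ᵥ (C *ᵥ y) := by
    have hT : Cᵀ = C := by simpa using hC.isHermitian.eq
    rw [dotProduct_mulVec, ← mulVec_transpose, hT, dotProduct_comm]
  have h := hC.dotProduct_mulVec_nonneg (x - y)
  simp only [star_trivial, mulVec_sub, dotProduct_sub, sub_dotProduct] at h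
  linarith

theorem isLeast_energy [DecidableEq m] (hB : ∀ j, (B j).PosDef)
    (hunit : IsUnit (operator P B)) (z : m → ℝ) :
    IsLeast {t : ℝ | ∃ zs : ∀ j, κ j → ℝ,
        z = ∑ j, P j *ᵥ zs j ∧ t = ∑ j, zs j ⬝ᵥ (B j *ᵥ zs j)}
      (z ⬝ᵥ ((operator P B)⁻¹ *ᵥ z)) := by
  set w := (operator P B)⁻¹ *ᵥ z with hw
  set ys : ∀ j, κ j → ℝ := fun j => (B j)⁻¹ *ᵥ ((P j)ᵀ *ᵥ w) with hys
  have hBys : ∀ j, B j *ᵥ ys j = (P j)ᵀ *ᵥ w := fun j => by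
    rw [hys, mulVec_mulVec, mul_nonsing_inv _ ((isUnit_iff_isUnit_det _).1 (hB j).isUnit),
      one_mulVec]
  have hsum : z = ∑ j, P j *ᵥ ys j := by
    rw [← operator_mulVec, hw, mulVec_mulVec,
      mul_nonsing_inv _ ((isUnit_iff_isUnit_det _).1 hunit), one_mulVec]
  have hpair : ∀ zs : ∀ j, κ j → ℝ, z = ∑ j, P j *ᵥ zs j →
      z ⬝ᵥ w = ∑ j, zs j ⬝ᵥ (B j *ᵥ ys j) := fun zs hzs => by
    simp only [hBys]
    rw [← dotProduct_sum_mulVec, ← hzs, dotProduct_comm]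
  refine ⟨⟨ys, hsum, hpair ys hsum⟩, ?_⟩
  rintro _ ⟨zs, hzs, rfl⟩
  have h := Finset.sum_le_sum fun j (_ : j ∈ Finset.univ) =>
    two_mul_dotProduct_sub_le (hB j).posSemidef (zs j) (ys j)
  rw [Finset.sum_sub_distrib, ← Finset.mul_sum, ← hpair zs hzs, ← hpair ys hsum] at h
  linarith

end AdditiveSchwarz

/-- Additive Schwarz lemma: the additive Schwarz preconditioner `M⁻¹` is invertible,
its inverse `M` is SPD, and `zᵀ M z` is the minimum of `∑ z_jᵀ A_j z_j` over all
decompositions `z = ∑ P_j z_j`, the minimum being attained. -/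
theorem stmt_1 (n N : ℕ) (A : Matrix (Fin n) (Fin n) ℝ) (hA : A.PosDef)
    (nj : Fin N → ℕ) (P : (j : Fin N) → Matrix (Fin n) (Fin (nj j)) ℝ)
    (hrank : ∀ j, Function.Injective (P j).mulVec)
    (hspan : ∀ z : Fin n → ℝ, ∃ zs : (j : Fin N) → Fin (nj j) → ℝ,
      z = ∑ j, (P j).mulVec (zs j))
    (Minv : Matrix (Fin n) (Fin n) ℝ)
    (hMinv : Minv = ∑ j, P j * ((P j)ᵀ * A * P j)⁻¹ * (P j)ᵀ) :
    IsUnit Minv ∧ (Minv⁻¹).PosDef ∧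
      ∀ z : Fin n → ℝ,
        IsLeast
          {t : ℝ | ∃ zs : (j : Fin N) → Fin (nj j) → ℝ,
            z = ∑ j, (P j).mulVec (zs j) ∧
            t = ∑ j, dotProduct (zs j) ((((P j)ᵀ * A * P j)).mulVec (zs j))}
          (dotProduct z ((Minv⁻¹).mulVec z)) := by
  have hB : ∀ j, ((P j)ᵀ * A * P j).PosDef := fun j => by
    simpa using hA.conjTranspose_mul_mul_same (hrank j)
  obtain rfl : Minv = AdditiveSchwarz.operator P fun j => (P j)ᵀ * A * P j := hMinv
  have hpos := AdditiveSchwarz.operator_posDef hB hspan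
  exact ⟨hpos.isUnit, hpos.inv, AdditiveSchwarz.isLeast_energy hB hpos.isUnit⟩
end

section
/- Let A ∈ ℝ^{n×n} be symmetric positive definite and let P_1,…,P_N with A_j = P_jᵀAP_j and M⁻¹ = Σ_{j=1}^N P_j A_j⁻¹ P_jᵀ be an additive Schwarz setup for A. Then the largest eigenvalue of M⁻¹A equals the supremum, over all families (z_1, …, z_N) with z_j ∈ ℝ^{n_j} and Σ_{j=1}^N P_j z_j ≠ 0, of the quotient (Σ_{j=1}^N P_j z_j)ᵀ A (Σ_{j=1}^N P_j z_j) / (Σ_{j=1}^N z_jᵀ A_j z_j), and this supremum is attained. -/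
open Matrix BigOperators

/-- The generalized Rayleigh quotient of a symmetric `K` relative to a positive definite `A`
attains its maximum at a generalized eigenvector. -/
theorem Matrix.PosDef.exists_max_generalized_eigenvector {ι : Type*} [Fintype ι] [Nonempty ι]
    {A K : Matrix ι ι ℝ} (hA : A.PosDef) (hK : K.IsHermitian) :
    ∃ (lam : ℝ) (v : ι → ℝ), v ≠ 0 ∧ K *ᵥ v = lam • A *ᵥ v ∧
      ∀ u : ι → ℝ, u ⬝ᵥ K *ᵥ u ≤ lam * (u ⬝ᵥ A *ᵥ u) := by
  have hpos : ∀ u : ι → ℝ, u ≠ 0 → 0 < u ⬝ᵥ A *ᵥ u := fun u hu => by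
    simpa using hA.dotProduct_mulVec_pos hu
  have hne : ∀ u ∈ Metric.sphere (0 : ι → ℝ) 1, u ≠ 0 := fun u hu =>
    ne_zero_of_mem_unit_sphere ⟨u, hu⟩
  obtain ⟨v, hv, hmax⟩ := (isCompact_sphere (0 : ι → ℝ) 1).exists_isMaxOn
    (NormedSpace.sphere_nonempty.mpr zero_le_one)
    (f := fun u => (u ⬝ᵥ K *ᵥ u) / (u ⬝ᵥ A *ᵥ u))
    (ContinuousOn.div (by fun_prop) (by fun_prop) fun u hu => (hpos u (hne u hu)).ne')
  have hv0 := hne v hv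
  set lam := (v ⬝ᵥ K *ᵥ v) / (v ⬝ᵥ A *ᵥ v) with hlam
  have hle : ∀ u : ι → ℝ, u ⬝ᵥ K *ᵥ u ≤ lam * (u ⬝ᵥ A *ᵥ u) := by
    intro u
    by_cases hu : u = 0
    · simp [hu]
    have hnu : ‖u‖ ≠ 0 := norm_ne_zero_iff.mpr hu
    have hmem : ‖u‖⁻¹ • u ∈ Metric.sphere (0 : ι → ℝ) 1 := by
      simp [norm_smul, hnu]
    have h := hmax hmem
    simp only [Set.mem_ofPred_eq, mulVec_smul, dotProduct_smul, smul_dotProduct, smul_eq_mul] at h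
    rw [mul_div_mul_left _ _ (inv_ne_zero hnu), mul_div_mul_left _ _ (inv_ne_zero hnu)] at h
    exact (div_le_iff₀ (hpos u hu)).mp h
  have hpsd : (lam • A - K).PosSemidef := by
    refine PosSemidef.of_dotProduct_mulVec_nonneg ?_ fun u => ?_
    · exact (hA.isHermitian.smul (IsSelfAdjoint.all lam)).sub hK
    · simpa [sub_mulVec, smul_mulVec, dotProduct_sub] using hle u
  have hzero : (lam • A - K) *ᵥ v = 0 := by
    rw [← hpsd.dotProduct_mulVec_zero_iff]
    simp [sub_mulVec, smul_mulVec, dotProduct_sub, hlam, (hpos v hv0).ne']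
  refine ⟨lam, v, hv0, ?_, hle⟩
  rw [sub_mulVec, smul_mulVec, sub_eq_zero] at hzero
  exact hzero.symm

/-- Real spectrum of a matrix in terms of eigenvectors. -/
theorem Matrix.mem_spectrum_iff_exists_mulVec_eq_smul {ι : Type*} [Fintype ι] [DecidableEq ι]
    {T : Matrix ι ι ℝ} {t : ℝ} :
    t ∈ spectrum ℝ T ↔ ∃ v : ι → ℝ, v ≠ 0 ∧ T *ᵥ v = t • v := by
  rw [← spectrum_toLin', ← Module.End.hasEigenvalue_iff_mem_spectrum]
  constructor
  · intro h
    obtain ⟨v, hv⟩ := h.exists_hasEigenvector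
    exact ⟨v, hv.2, by simpa using hv.apply_eq_smul⟩
  · rintro ⟨v, hv, h⟩
    exact Module.End.hasEigenvalue_of_hasEigenvector
      (Module.End.hasEigenvector_iff.mpr ⟨Module.End.mem_eigenspace_iff.mpr (by simpa using h), hv⟩)

/-- Characterization of the largest eigenvalue of the additive-Schwarz-preconditioned
matrix `M⁻¹A` as the attained supremum of the quotient
`(∑ P_j z_j)ᵀ A (∑ P_j z_j) / ∑ z_jᵀ A_j z_j` over decomposition families with
`∑ P_j z_j ≠ 0`. -/
theorem stmt_5 (n N : ℕ) (hn : 0 < n) (A : Matrix (Fin n) (Fin n) ℝ) (hA : A.PosDef)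
    (nj : Fin N → ℕ) (P : (j : Fin N) → Matrix (Fin n) (Fin (nj j)) ℝ)
    (hrank : ∀ j, Function.Injective (P j).mulVec)
    (hspan : ∀ z : Fin n → ℝ, ∃ zs : (j : Fin N) → Fin (nj j) → ℝ,
      z = ∑ j, (P j).mulVec (zs j))
    (Minv : Matrix (Fin n) (Fin n) ℝ)
    (hMinv : Minv = ∑ j, P j * ((P j)ᵀ * A * P j)⁻¹ * (P j)ᵀ) :
    ∃ lam : ℝ, IsGreatest (spectrum ℝ (Minv * A)) lam ∧
      IsGreatest
        {t : ℝ | ∃ zs : (j : Fin N) → Fin (nj j) → ℝ,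
          (∑ j, (P j).mulVec (zs j)) ≠ 0 ∧
          t = dotProduct (∑ j, (P j).mulVec (zs j))
                (A.mulVec (∑ j, (P j).mulVec (zs j))) /
              (∑ j, dotProduct (zs j) ((((P j)ᵀ * A * P j)).mulVec (zs j)))} lam := by
  have : Nonempty (Fin n) := ⟨⟨0, hn⟩⟩
  have hAt : Aᵀ = A := by simpa using hA.isHermitian.eq
  have hpos : ∀ u : Fin n → ℝ, u ≠ 0 → 0 < u ⬝ᵥ A *ᵥ u := fun u hu => by
    simpa using hA.dotProduct_mulVec_pos hu
  have hB : ∀ j, ((P j)ᵀ * A * P j).PosDef := fun j => by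
    simpa using hA.conjTranspose_mul_mul_same (hrank j)
  have hBt : ∀ j, ((P j)ᵀ * A * P j)ᵀ = (P j)ᵀ * A * P j := fun j => by
    simpa using (hB j).isHermitian.eq
  have hBpos : ∀ j (z : Fin (nj j) → ℝ), 0 ≤ z ⬝ᵥ ((P j)ᵀ * A * P j) *ᵥ z := fun j z => by
    simpa using (hB j).posSemidef.dotProduct_mulVec_nonneg z
  have hMt : Minvᵀ = Minv := by
    simp only [hMinv, transpose_sum, transpose_mul, transpose_nonsing_inv, transpose_transpose,
      hAt, Matrix.mul_assoc]
  let y : (Fin n → ℝ) → (j : Fin N) → Fin (nj j) → ℝ := fun u j =>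
    ((P j)ᵀ * A * P j)⁻¹ *ᵥ ((P j)ᵀ *ᵥ (A *ᵥ u))
  have hBy : ∀ u j, ((P j)ᵀ * A * P j) *ᵥ y u j = (P j)ᵀ *ᵥ (A *ᵥ u) := fun u j => by
    have := (hB j).isUnit
    rw [isUnit_iff_isUnit_det] at this
    simp only [y]
    rw [mulVec_mulVec, mul_nonsing_inv _ this, one_mulVec]
  have hPy : ∀ u, ∑ j, P j *ᵥ y u j = (Minv * A) *ᵥ u := fun u => by
    simp only [hMinv, y, Finset.sum_mul, sum_mulVec, mulVec_mulVec, Matrix.mul_assoc]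
  have hcross : ∀ u (z : (j : Fin N) → Fin (nj j) → ℝ),
      ∑ j, z j ⬝ᵥ ((P j)ᵀ * A * P j) *ᵥ y u j = (∑ j, P j *ᵥ z j) ⬝ᵥ A *ᵥ u := fun u z => by
    simp only [hBy, sum_dotProduct]
    refine Finset.sum_congr rfl fun j _ => ?_
    rw [dotProduct_mulVec, vecMul_transpose]
  have hsymm : ∀ u w : Fin n → ℝ, u ⬝ᵥ A *ᵥ w = w ⬝ᵥ A *ᵥ u := fun u w => by
    rw [dotProduct_mulVec, ← mulVec_transpose, hAt, dotProduct_comm]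
  have henergy : ∀ u, ∑ j, y u j ⬝ᵥ ((P j)ᵀ * A * P j) *ᵥ y u j
      = u ⬝ᵥ (A * Minv * A) *ᵥ u := fun u => by
    rw [hcross, hPy, hsymm, mulVec_mulVec, Matrix.mul_assoc]
  have hK : (A * Minv * A).IsHermitian := by
    simp [IsHermitian, conjTranspose_eq_transpose_of_trivial, transpose_mul, hAt, hMt,
      Matrix.mul_assoc]
  obtain ⟨lam, v, hv, hKv, hle⟩ := hA.exists_max_generalized_eigenvector hK
  have hAinj : Function.Injective A.mulVec := mulVec_injective_iff_isUnit.mpr hA.isUnit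
  have hTv : (Minv * A) *ᵥ v = lam • v := hAinj <| by
    simpa only [mulVec_mulVec, mulVec_smul, Matrix.mul_assoc] using hKv
  -- The energy of `∑ P_j z_j` expanded through the blockwise corrections `y`.
  have hquad : ∀ (z : (j : Fin N) → Fin (nj j) → ℝ) (s : ℝ) (u : Fin n → ℝ),
      u = ∑ j, P j *ᵥ z j →
      0 ≤ ∑ j, z j ⬝ᵥ ((P j)ᵀ * A * P j) *ᵥ z j - 2 * s * (u ⬝ᵥ A *ᵥ u)
        + s ^ 2 * (u ⬝ᵥ (A * Minv * A) *ᵥ u) := fun z s u hu => by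
    have h1 : ∑ j, z j ⬝ᵥ ((P j)ᵀ * A * P j) *ᵥ y u j = u ⬝ᵥ A *ᵥ u := by
      rw [hcross, ← hu]
    have h := Finset.sum_nonneg fun j (_ : j ∈ Finset.univ) => hBpos j (z j - s • y u j)
    have h2 : ∀ j, y u j ⬝ᵥ ((P j)ᵀ * A * P j) *ᵥ z j
        = z j ⬝ᵥ ((P j)ᵀ * A * P j) *ᵥ y u j := fun j => by
      rw [dotProduct_mulVec, ← mulVec_transpose, hBt, dotProduct_comm]
    simp only [mulVec_sub, mulVec_smul, sub_dotProduct, dotProduct_sub, smul_dotProduct,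
      dotProduct_smul, smul_eq_mul, h2, Finset.sum_sub_distrib, ← Finset.mul_sum, h1,
      henergy] at h
    linarith
  have hlam : 0 < lam := by
    obtain ⟨z, hz⟩ := hspan v
    by_contra! hlam
    set D := ∑ j, z j ⬝ᵥ ((P j)ᵀ * A * P j) *ᵥ z j
    have ha := hpos v hv
    have h := hquad z ((D + 1) / (v ⬝ᵥ A *ᵥ v)) v hz
    have h3 := mul_nonpos_of_nonneg_of_nonpos (sq_nonneg ((D + 1) / (v ⬝ᵥ A *ᵥ v)))
      ((hle v).trans (mul_nonpos_of_nonpos_of_nonneg hlam ha.le))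
    have hD : 0 ≤ D := Finset.sum_nonneg fun j _ => hBpos j (z j)
    rw [mul_assoc, div_mul_cancel₀ _ ha.ne'] at h
    linarith
  refine ⟨lam, ⟨mem_spectrum_iff_exists_mulVec_eq_smul.mpr ⟨v, hv, hTv⟩, ?_⟩, ⟨y v, ?_, ?_⟩, ?_⟩
  · intro t ht
    obtain ⟨w, hw, hTw⟩ := mem_spectrum_iff_exists_mulVec_eq_smul.mp ht
    have h := hle w
    rw [Matrix.mul_assoc, ← mulVec_mulVec, hTw, mulVec_smul, dotProduct_smul, smul_eq_mul] at h
    exact le_of_mul_le_mul_right h (hpos w hw)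
  · rw [hPy, hTv]
    exact smul_ne_zero hlam.ne' hv
  · rw [henergy, hPy, hTv, hKv]
    simp only [mulVec_smul, dotProduct_smul, smul_dotProduct, smul_eq_mul]
    have := (hpos v hv).ne'
    field_simp
  · rintro t ⟨z, hu, rfl⟩
    have h := hquad z lam⁻¹ _ rfl
    have hb := hle (∑ j, P j *ᵥ z j)
    have ha := hpos _ hu
    set a := (∑ j, P j *ᵥ z j) ⬝ᵥ A *ᵥ (∑ j, P j *ᵥ z j)
    set D := ∑ j, z j ⬝ᵥ ((P j)ᵀ * A * P j) *ᵥ z j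
    have h4 : lam⁻¹ * a ≤ D := by
      have h5 := mul_le_mul_of_nonneg_left hb (sq_nonneg lam⁻¹)
      have h6 : lam⁻¹ ^ 2 * (lam * a) = lam⁻¹ * a := by field_simp
      linarith
    have hD : 0 < D := (mul_pos (inv_pos.mpr hlam) ha).trans_le h4
    rw [div_le_iff₀ hD]
    exact (inv_mul_le_iff₀ hlam).mp h4
end

section
/- Let A ∈ ℝ^{n×n} be symmetric positive definite and M ∈ ℝ^{n×n} invertible, and define the symmetrized smoother P = M⁻¹ + M⁻ᵀ − M⁻ᵀ A M⁻¹ = M⁻ᵀ(M + Mᵀ − A)M⁻¹, so that I − P A = (I − M⁻ᵀA)(I − M⁻¹A) is the error propagation matrix of a double fixed-point iteration with a sweep of M⁻¹ followed by its adjoint M⁻ᵀ. Then every eigenvalue of P A is real and at most 1; moreover, all eigenvalues of P A are strictly positive if and only if M + Mᵀ − A is symmetric positive definite. -/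
open Matrix BigOperators

namespace Matrix

variable {n : Type*} [Fintype n] [DecidableEq n]

open scoped MatrixOrder in
/-- A real positive definite matrix factors as `Bᵀ * B` with `B` invertible. -/
lemma PosDef.exists_isUnit_transpose_mul_self {A : Matrix n n ℝ} (hA : A.PosDef) :
    ∃ B : Matrix n n ℝ, IsUnit B ∧ A = Bᵀ * B := by
  obtain ⟨B, hB⟩ := CStarAlgebra.nonneg_iff_eq_star_mul_self.mp hA.posSemidef.nonneg
  refine ⟨B, ?_, by simpa [star_eq_conjTranspose] using hB⟩
  have hu := hA.isUnit
  rw [hB, isUnit_iff_isUnit_det, det_mul] at hu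
  exact (isUnit_iff_isUnit_det B).mpr (isUnit_of_mul_isUnit_right hu)

/-- If a real matrix has the characteristic polynomial of a symmetric matrix `H`, its complex
spectrum consists of the eigenvalues of `H`. -/
lemma IsHermitian.mem_spectrum_map_ofReal_iff {H X : Matrix n n ℝ} (hH : H.IsHermitian)
    (h : X.charpoly = H.charpoly) {μ : ℂ} :
    μ ∈ spectrum ℂ (X.map Complex.ofReal) ↔ ∃ i, μ = hH.eigenvalues i := by
  rw [mem_spectrum_iff_isRoot_charpoly]
  change (X.map Complex.ofRealHom).charpoly.IsRoot μ ↔ _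
  rw [charpoly_map, h, hH.charpoly_eq]
  simp [Polynomial.map_prod, Polynomial.IsRoot, Polynomial.eval_prod, Finset.prod_eq_zero_iff,
    sub_eq_zero]

lemma IsHermitian.eigenvalues_le_one {H : Matrix n n ℝ} (hH : H.IsHermitian)
    (h : (1 - H).PosSemidef) (i : n) : hH.eigenvalues i ≤ 1 := by
  have hs := (posSemidef_iff_isHermitian_and_spectrum_nonneg.mp h).2
  have hi : 1 - hH.eigenvalues i ∈ spectrum ℝ (1 - H) := by
    have := hH.eigenvalues_mem_spectrum_real i
    rw [spectrum.mem_iff] at this ⊢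
    rw [IsUnit.sub_iff] at this
    simpa using this
  simpa using hs hi

/-- The symmetrized smoother is congruent to `M + Mᵀ - A`. -/
lemma symmetrized_smoother_eq {A M : Matrix n n ℝ} (hM : IsUnit M) :
    M⁻¹ + (Mᵀ)⁻¹ - (Mᵀ)⁻¹ * A * M⁻¹ = (M⁻¹)ᵀ * (M + Mᵀ - A) * M⁻¹ := by
  have hdet := (isUnit_iff_isUnit_det M).mp hM
  have hdet' : IsUnit Mᵀ.det := by rwa [det_transpose]
  rw [transpose_nonsing_inv]
  simp only [mul_add, mul_sub, add_mul, sub_mul]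
  rw [nonsing_inv_mul _ hdet', mul_assoc _ M, mul_nonsing_inv _ hdet, mul_one, one_mul]
  abel

end Matrix

/-- Spectrum of the symmetrized smoother `P = M⁻¹ + M⁻ᵀ - M⁻ᵀ A M⁻¹`:
`I - P A = (I - M⁻ᵀA)(I - M⁻¹A)`, every eigenvalue of `P A` is real and at most `1`,
and all eigenvalues of `P A` are strictly positive iff `M + Mᵀ - A` is SPD. -/
theorem stmt_12 (n : ℕ) (A M : Matrix (Fin n) (Fin n) ℝ)
    (hA : A.PosDef) (hM : IsUnit M)
    (P : Matrix (Fin n) (Fin n) ℝ)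
    (hP : P = M⁻¹ + (Mᵀ)⁻¹ - (Mᵀ)⁻¹ * A * M⁻¹) :
    (1 : Matrix (Fin n) (Fin n) ℝ) - P * A =
      ((1 : Matrix (Fin n) (Fin n) ℝ) - (Mᵀ)⁻¹ * A) *
        ((1 : Matrix (Fin n) (Fin n) ℝ) - M⁻¹ * A) ∧
    (∀ μ ∈ spectrum ℂ ((P * A).map Complex.ofReal), μ.im = 0 ∧ μ.re ≤ 1) ∧
    ((∀ μ ∈ spectrum ℂ ((P * A).map Complex.ofReal), 0 < μ.re) ↔
      (M + Mᵀ - A).PosDef) := by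
  have hAt : Aᵀ = A := by simpa using hA.isHermitian.eq
  have hPt : Pᵀ = P := by
    rw [hP]
    simp only [transpose_sub, transpose_add, transpose_mul, transpose_nonsing_inv,
      transpose_transpose, hAt, mul_assoc]
    abel
  obtain ⟨B, hB, hAB⟩ := hA.exists_isUnit_transpose_mul_self
  have hH : (B * P * Bᵀ).IsHermitian := by
    simp [IsHermitian, hPt, mul_assoc]
  have hchar : (P * A).charpoly = (B * P * Bᵀ).charpoly := by
    rw [hAB, ← mul_assoc, charpoly_mul_comm, mul_assoc]
  have hle : (1 - B * P * Bᵀ).PosSemidef := by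
    have h : 1 - B * P * Bᵀ = (1 - B * M⁻¹ * Bᵀ)ᴴ * (1 - B * M⁻¹ * Bᵀ) := by
      simp only [conjTranspose_eq_transpose_of_trivial, transpose_sub, transpose_one,
        transpose_mul, transpose_transpose, transpose_nonsing_inv]
      rw [hP, hAB]
      noncomm_ring
    rw [h]
    exact posSemidef_conjTranspose_mul_self _
  have hMinv : IsUnit M⁻¹ := isUnit_nonsing_inv_iff.mpr hM
  have hpos : (B * P * Bᵀ).PosDef ↔ (M + Mᵀ - A).PosDef := by
    have h₁ := IsUnit.posDef_star_right_conjugate_iff (x := P) hB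
    have h₂ := IsUnit.posDef_star_left_conjugate_iff (x := M + Mᵀ - A) hMinv
    rw [star_eq_conjTranspose, conjTranspose_eq_transpose_of_trivial] at h₁ h₂
    rw [h₁, hP, symmetrized_smoother_eq hM, h₂]
  refine ⟨by rw [hP]; noncomm_ring, fun μ hμ ↦ ?_, ?_⟩
  · obtain ⟨i, rfl⟩ := (hH.mem_spectrum_map_ofReal_iff hchar).mp hμ
    exact ⟨Complex.ofReal_im _, by simpa using hH.eigenvalues_le_one hle i⟩
  · simp only [← hpos, hH.posDef_iff_eigenvalues_pos, hH.mem_spectrum_map_ofReal_iff hchar,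
      forall_exists_index, forall_eq_apply_imp_iff, Complex.ofReal_re]
end
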